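/- Let φ be an isometry in O⁺(Λ_ℚ). There exist a positive integer k, elements u_i ∈ L satisfying (u_i,u_i) ≥ 2 for 1 ≤ i ≤ k, and elements γ_i ∈ Γ for 0 ≤ i ≤ k, such that φ = (−1)^k · γ_k ∘ ρ_{u_k} ∘ γ_{k−1} ∘ ρ_{u_{k−1}} ∘ ⋯ ∘ γ_1 ∘ ρ_{u_1} ∘ γ_0, where ρ_{u_i}(x) = x − (2(u_i,x)/(u_i,u_i))·u_i is the reflection of Λ_ℚ in the hyperplane orthogonal to u_i. -/

import Mathlib

noncomputable section

open LinearMap (BilinForm)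

variable {V : Type*} [AddCommGroup V] [Module ℚ V]

/-- The group `O(B)` of isometries of a bilinear form `B`. -/
def isomGroup (B : BilinForm ℚ V) : Subgroup (V ≃ₗ[ℚ] V) where
  carrier := {g | ∀ x y, B (g x) (g y) = B x y}
  one_mem' := fun _ _ => rfl
  mul_mem' := by
    intro a b ha hb x y
    calc B ((a * b) x) ((a * b) y) = B (a (b x)) (a (b y)) := rfl
      _ = B (b x) (b y) := ha _ _
      _ = B x y := hb _ _
  inv_mem' := by
    intro a ha x y
    calc B (a⁻¹ x) (a⁻¹ y) = B (a (a⁻¹ x)) (a (a⁻¹ y)) := (ha _ _).symm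
      _ = B x y := by
          show B (a (a.symm x)) (a (a.symm y)) = B x y
          rw [a.apply_symm_apply, a.apply_symm_apply]

/-- `P` is a 3-dimensional positive-definite subspace for `B`. -/
def IsPosDefThree (B : BilinForm ℚ V) (P : Submodule ℚ V) : Prop :=
  Module.finrank ℚ P = 3 ∧ ∀ x ∈ P, x ≠ 0 → 0 < B x x

/-- `g` preserves the orientation of the positive cone of `B`: for some 3-dimensional
positive-definite subspace `P`, the composition of the restriction of `g` to `P` with the
`B`-orthogonal projection back onto `P` has positive determinant. -/
def OrientPos (B : BilinForm ℚ V) (g : V ≃ₗ[ℚ] V) : Prop :=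
  ∃ P : Submodule ℚ V, IsPosDefThree B P ∧
    ∃ π : V →ₗ[ℚ] V, (∀ x, π x ∈ P) ∧ (∀ x, ∀ p ∈ P, B (x - π x) p = 0) ∧
      ∃ q : ↥P →ₗ[ℚ] ↥P, (∀ x : ↥P, (q x : V) = π (g (x : V))) ∧ 0 < LinearMap.det q

/-- The dual lattice `L* = {x : (x, L) ⊆ ℤ}` of a lattice `L`. -/
def dualLattice (B : BilinForm ℚ V) (L : Submodule ℤ V) : Submodule ℤ V where
  carrier := {x | ∀ y ∈ L, ∃ n : ℤ, B x y = (n : ℚ)}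
  zero_mem' := by
    intro y _
    exact ⟨0, by simp⟩
  add_mem' := by
    intro a b ha hb y hy
    obtain ⟨m, hm⟩ := ha y hy
    obtain ⟨n, hn⟩ := hb y hy
    refine ⟨m + n, ?_⟩
    rw [map_add, LinearMap.add_apply, hm, hn]
    push_cast
    ring
  smul_mem' := by
    intro c x hx y hy
    obtain ⟨n, hn⟩ := hx y hy
    refine ⟨c * n, ?_⟩
    have h1 : ((c : ℚ)) • x = c • x := Int.cast_smul_eq_zsmul ℚ c x
    rw [← h1, map_smul, LinearMap.smul_apply, hn, smul_eq_mul]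
    push_cast
    ring

/-- `g` maps the lattice `L` bijectively onto itself. -/
def PreservesLattice (L : Submodule ℤ V) (g : V ≃ₗ[ℚ] V) : Prop :=
  (∀ x ∈ L, g x ∈ L) ∧ ∀ x ∈ L, g.symm x ∈ L

/-- `g` acts on the discriminant group `L*/L` as `+1` or as `-1`. -/
def ActsAsPMOne (B : BilinForm ℚ V) (L : Submodule ℤ V) (g : V ≃ₗ[ℚ] V) : Prop :=
  (∀ x ∈ dualLattice B L, g x - x ∈ L) ∨ ∀ x ∈ dualLattice B L, g x + x ∈ L

/-- Membership in the subgroup `Γ ⊆ O⁺(Λ)` of isometries preserving the lattice and acting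
on the discriminant group as `±1`. -/
def InGamma (B : BilinForm ℚ V) (L : Submodule ℤ V) (g : V ≃ₗ[ℚ] V) : Prop :=
  g ∈ isomGroup B ∧ PreservesLattice L g ∧ OrientPos B g ∧ ActsAsPMOne B L g

/-- The bilinear form of `Λ_ℚ = L_ℚ ⊕ ℚδ` with `(δ, δ) = -2d`. -/
def prodForm (B : BilinForm ℚ V) (d : ℤ) : BilinForm ℚ (V × ℚ) :=
  LinearMap.mk₂ ℚ (fun p q => B p.1 q.1 - (2 * (d : ℚ)) * (p.2 * q.2))
    (fun p p' q => by
      simp only [Prod.fst_add, Prod.snd_add, map_add, LinearMap.add_apply]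
      ring)
    (fun c p q => by
      simp only [Prod.smul_fst, Prod.smul_snd, map_smul, LinearMap.smul_apply, smul_eq_mul]
      ring)
    (fun p q q' => by
      simp only [Prod.fst_add, Prod.snd_add, map_add, LinearMap.add_apply]
      ring)
    (fun p c q => by
      simp only [Prod.smul_fst, Prod.smul_snd, map_smul, LinearMap.smul_apply, smul_eq_mul]
      ring)

/-- The lattice `ℤ ⊆ ℚ`, i.e. the ℤ-span of `1`. -/
def intLat : Submodule ℤ ℚ := Submodule.span ℤ {(1 : ℚ)}

/-- Membership in the subgroup `O(L_ℚ) ⊆ O(Λ_ℚ)`: isometries of `Λ_ℚ = L_ℚ ⊕ ℚδ` preserving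
`L_ℚ` and fixing `δ`, i.e. extensions of isometries of `L_ℚ` by the identity on `δ`. -/
def InOLQ (B : BilinForm ℚ V) (d : ℤ) (g : (V × ℚ) ≃ₗ[ℚ] (V × ℚ)) : Prop :=
  g ∈ isomGroup (prodForm B d) ∧ (∀ x : V, (g (x, 0)).2 = 0) ∧
    g ((0 : V), (1 : ℚ)) = ((0 : V), (1 : ℚ))

/-- `B` has signature `(3, s)`: an orthogonal direct sum decomposition into a positive-definite
subspace of dimension `3` and a negative-definite subspace of dimension `s`. -/
def HasSignatureThree (B : BilinForm ℚ V) (s : ℕ) : Prop :=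
  ∃ P N : Submodule ℚ V, IsCompl P N ∧ (∀ x ∈ P, ∀ y ∈ N, B x y = 0) ∧
    Module.finrank ℚ P = 3 ∧ Module.finrank ℚ N = s ∧
    (∀ x ∈ P, x ≠ 0 → 0 < B x x) ∧ ∀ x ∈ N, x ≠ 0 → B x x < 0

/-- `L` contains a sublattice isometric to `U ⊕ U ⊕ U`, where `U` is the hyperbolic plane with
isotropic basis `e, f` and `(e, f) = -1`. -/
def ContainsU3 (B : BilinForm ℚ V) (L : Submodule ℤ V) : Prop :=
  ∃ e f : Fin 3 → V, (∀ i, e i ∈ L) ∧ (∀ i, f i ∈ L) ∧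
    (∀ i j, B (e i) (e j) = 0) ∧ (∀ i j, B (f i) (f j) = 0) ∧
    ∀ i j, B (e i) (f j) = if i = j then -1 else 0

/-- `l` is a primitive element of the lattice `L`: `l ∈ L`, `l ≠ 0` and `L/ℤl` is
torsion-free. -/
def IsPrimitiveIn (L : Submodule ℤ V) (l : V) : Prop :=
  l ∈ L ∧ l ≠ 0 ∧ ∀ y ∈ L, ∀ n : ℤ, n ≠ 0 →
    n • y ∈ Submodule.span ℤ ({l} : Set V) → y ∈ Submodule.span ℤ ({l} : Set V)

/-- The reflection `ρ_u(x) = x - (2(u,x)/(u,u))·u` (as a plain function). -/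
def reflFun (B : BilinForm ℚ V) (u : V) (x : V) : V :=
  x - (2 * B u x / B u u) • u

section Reflections

variable {X : Type*} [AddCommGroup X] [Module ℚ X]

/-- The reflection in the hyperplane orthogonal to `v`; it is the identity when `v` is
isotropic. -/
def orthRefl (Q : BilinForm ℚ X) (v : X) : X ≃ₗ[ℚ] X :=
  LinearEquiv.ofInvolutive
    { toFun := fun x => x - (2 * Q v x / Q v v) • v
      map_add' := by
        intro x y
        rw [map_add]
        module
      map_smul' := by
        intro c x
        simp only [map_smul, smul_eq_mul, RingHom.id_apply]
        module }
    (by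
      intro x
      simp only [LinearMap.coe_mk, AddHom.coe_mk, map_sub, map_smul]
      by_cases h : Q v v = 0
      · simp [h]
      · match_scalars
        · ring
        · field_simp
          ring)

lemma orthRefl_apply (Q : BilinForm ℚ X) (v x : X) :
    orthRefl Q v x = x - (2 * Q v x / Q v v) • v := rfl

lemma orthRefl_refl (Q : BilinForm ℚ X) (v x : X) : orthRefl Q v (orthRefl Q v x) = x :=
  (orthRefl Q v).apply_symm_apply x

lemma orthRefl_mul_self (Q : BilinForm ℚ X) (v : X) : orthRefl Q v * orthRefl Q v = 1 :=
  LinearEquiv.ext fun x => orthRefl_refl Q v x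

lemma orthRefl_inv (Q : BilinForm ℚ X) (v : X) : (orthRefl Q v)⁻¹ = orthRefl Q v := rfl

lemma orthRefl_eq_self {Q : BilinForm ℚ X} {v x : X} (h : Q v x = 0) : orthRefl Q v x = x := by
  simp [orthRefl_apply, h]

lemma orthRefl_self {Q : BilinForm ℚ X} {v : X} (h : Q v v ≠ 0) : orthRefl Q v v = -v := by
  rw [orthRefl_apply, mul_div_assoc, div_self h]
  module

lemma orthRefl_mem_isomGroup {Q : BilinForm ℚ X} (hQ : ∀ x y, Q x y = Q y x) (v : X) :
    orthRefl Q v ∈ isomGroup Q := by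
  intro x y
  simp only [orthRefl_apply, map_sub, map_smul, LinearMap.sub_apply, LinearMap.smul_apply,
    smul_eq_mul, hQ x v]
  by_cases h : Q v v = 0
  · simp [h]
  · field_simp
    ring

lemma orthRefl_smul (Q : BilinForm ℚ X) {c : ℚ} (hc : c ≠ 0) (v : X) :
    orthRefl Q (c • v) = orthRefl Q v := by
  ext x
  simp only [orthRefl_apply, map_smul, LinearMap.smul_apply, smul_eq_mul, smul_smul]
  by_cases h : Q v v = 0
  · simp [h]
  · congr 2
    field_simp

lemma orthRefl_sub_apply {Q : BilinForm ℚ X} (hQ : ∀ x y, Q x y = Q y x) {x y : X}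
    (hxy : Q x x = Q y y) (h : Q (x - y) (x - y) ≠ 0) : orthRefl Q (x - y) x = y := by
  have h2 : 2 * Q (x - y) x = Q (x - y) (x - y) := by
    simp only [map_sub, LinearMap.sub_apply, hQ y x]
    linarith
  rw [orthRefl_apply, h2, div_self h]
  module

/-- Two vectors of the same nonzero norm in a subspace `S` are related by a product of
reflections in vectors of `S`. -/
lemma exists_orthRefl_map {Q : BilinForm ℚ X} (hQ : ∀ x y, Q x y = Q y x)
    (H : Subgroup (X ≃ₗ[ℚ] X)) (S : Submodule ℚ X) (hS : ∀ s ∈ S, orthRefl Q s ∈ H)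
    {x y : X} (hx : x ∈ S) (hy : y ∈ S) (hxy : Q x x = Q y y) (h0 : Q y y ≠ 0) :
    ∃ r ∈ H, r x = y ∧ ∀ z, Q x z = 0 → Q y z = 0 → r z = z := by
  by_cases h : Q (x - y) (x - y) = 0
  · have h' : Q (x - -y) (x - -y) ≠ 0 := by
      intro h'
      apply h0
      simp only [map_sub, map_neg, LinearMap.sub_apply, LinearMap.neg_apply] at h h'
      linarith
    refine ⟨orthRefl Q y * orthRefl Q (x - -y), mul_mem (hS _ hy)
      (hS _ (sub_mem hx (neg_mem hy))), ?_, ?_⟩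
    · rw [LinearEquiv.mul_apply, orthRefl_sub_apply hQ (by simpa using hxy) h', map_neg,
        orthRefl_self h0, neg_neg]
    · intro z hxz hyz
      have hz : Q (x - -y) z = 0 := by simp [hxz, hyz]
      rw [LinearEquiv.mul_apply, orthRefl_eq_self hz, orthRefl_eq_self hyz]
  · refine ⟨orthRefl Q (x - y), hS _ (sub_mem hx hy), orthRefl_sub_apply hQ hxy h, ?_⟩
    intro z hxz hyz
    exact orthRefl_eq_self (by simp [hxz, hyz])

/-- In the plane spanned by `x` and `y`, with `z` orthogonal to `y` and `w` orthogonal to `x`,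
one has `ρ_x ρ_y = ρ_w ρ_z`. -/
lemma orthRefl_mul_orthRefl_eq {Q : BilinForm ℚ X} (hQ : ∀ x y, Q x y = Q y x) {x y : X}
    (hx : Q x x ≠ 0) (hy : Q y y ≠ 0) (hD : Q x x * Q y y - Q x y ^ 2 ≠ 0) :
    orthRefl Q x * orthRefl Q y =
      orthRefl Q (Q x x • y - Q x y • x) * orthRefl Q (Q y y • x - Q x y • y) := by
  have key : orthRefl Q (Q x x • y - Q x y • x) * orthRefl Q x =
      orthRefl Q (Q y y • x - Q x y • y) * orthRefl Q y := by
    ext v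
    have e1 : Q (Q x x • y - Q x y • x) (Q x x • y - Q x y • x) =
        Q x x * (Q x x * Q y y - Q x y ^ 2) := by
      simp only [map_sub, map_smul, LinearMap.sub_apply, LinearMap.smul_apply, smul_eq_mul,
        hQ y x]
      ring
    have e2 : Q (Q y y • x - Q x y • y) (Q y y • x - Q x y • y) =
        Q y y * (Q x x * Q y y - Q x y ^ 2) := by
      simp only [map_sub, map_smul, LinearMap.sub_apply, LinearMap.smul_apply, smul_eq_mul,
        hQ y x]
      ring
    simp only [LinearEquiv.mul_apply, orthRefl_apply, e1, e2]
    simp only [map_sub, map_smul, LinearMap.sub_apply, LinearMap.smul_apply, smul_eq_mul, hQ y x]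
    generalize Q x v = p
    generalize Q y v = q
    generalize Q x x = a at *
    generalize Q y y = b at *
    generalize Q x y = c at *
    match_scalars
    · ring
    · field_simp
      ring
    · field_simp
      ring
  have h1 := congrArg (fun g => orthRefl Q (Q x x • y - Q x y • x) * g * orthRefl Q y) key
  simp only [mul_assoc] at h1
  rw [← mul_assoc, orthRefl_mul_self, orthRefl_mul_self, one_mul, mul_one] at h1
  exact h1

end Reflections

section Orientation

variable {X : Type*} [AddCommGroup X] [Module ℚ X]

/-- The compression of `g` to the subspace `P` along a projection `π` onto `P`. -/
def compression (P : Submodule ℚ X) (π : X →ₗ[ℚ] X) (hπ : ∀ x, π x ∈ P) (g : X ≃ₗ[ℚ] X) :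
    ↥P →ₗ[ℚ] ↥P :=
  LinearMap.codRestrict P (π ∘ₗ (g : X →ₗ[ℚ] X) ∘ₗ P.subtype) fun x => hπ (g x)

lemma compression_apply (P : Submodule ℚ X) (π : X →ₗ[ℚ] X) (hπ : ∀ x, π x ∈ P)
    (g : X ≃ₗ[ℚ] X) (x : P) : (compression P π hπ g x : X) = π (g x) := rfl

/-- Multiplying by the reflection in `v` multiplies the determinant of the compression to a
maximal positive-definite subspace by a factor of sign opposite to that of `(v, v)`. -/
lemma det_compression_orthRefl_mul [FiniteDimensional ℚ X] {Q : BilinForm ℚ X}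
    (hQ : ∀ x y, Q x y = Q y x) {P : Submodule ℚ X} (hP : ∀ x ∈ P, x ≠ 0 → 0 < Q x x)
    (hneg : ∀ x, (∀ p ∈ P, Q x p = 0) → x ≠ 0 → Q x x < 0)
    {π : X →ₗ[ℚ] X} (hπ : ∀ x, π x ∈ P) (hπ' : ∀ x, ∀ p ∈ P, Q (x - π x) p = 0)
    {h : X ≃ₗ[ℚ] X} (hh : h ∈ isomGroup Q)
    (hdet : LinearMap.det (compression P π hπ h) ≠ 0) {v : X} (hv : Q v v ≠ 0) :
    ∃ c : ℚ, c * Q v v < 0 ∧ LinearMap.det (compression P π hπ (orthRefl Q v * h)) =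
      LinearMap.det (compression P π hπ h) * c := by
  set A := compression P π hπ h with hA
  obtain ⟨p, hp⟩ : ∃ p, A p = ⟨π v, hπ v⟩ :=
    (LinearMap.equivOfDetNeZero A hdet).surjective ⟨π v, hπ v⟩
  have hp' : π (h p) = π v := congrArg Subtype.val hp
  let f : Module.Dual ℚ P := -(2 / Q v v) • (Q v ∘ₗ (h : X →ₗ[ℚ] X) ∘ₗ P.subtype)
  have hf : ∀ x : P, f x = -(2 / Q v v) * Q v (h x) := fun x => rfl
  refine ⟨1 + f p, ?_, ?_⟩
  · have e : (1 + f p) * Q v v = Q v v - 2 * Q v (h p) := by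
      rw [hf]
      field_simp
      ring
    have e2 : Q v v - 2 * Q v (h p) = Q (v - h p) (v - h p) - Q (p : X) (p : X) := by
      rw [← hh p p]
      simp only [map_sub, LinearMap.sub_apply, hQ (h p) v]
      ring
    rw [e, e2]
    have hperp : ∀ q ∈ P, Q (v - h p) q = 0 := by
      intro q hq
      have h1 := hπ' v q hq
      have h2 := hπ' (h p) q hq
      rw [hp'] at h2
      simp only [map_sub, LinearMap.sub_apply] at h1 h2 ⊢
      linarith
    by_cases hp0 : (p : X) = 0
    · have : v ≠ 0 := by
        rintro rfl
        simp at hv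
      have h3 := hneg (v - h p) hperp (by rwa [hp0, map_zero, sub_zero])
      rw [hp0] at h3 ⊢
      simpa using h3
    · have h3 := hP p p.2 hp0
      have h4 : Q (v - h p) (v - h p) ≤ 0 := by
        by_cases h5 : v - h p = 0
        · simp [h5]
        · exact (hneg _ hperp h5).le
      linarith
  · have : compression P π hπ (orthRefl Q v * h) = A * LinearMap.transvection f p := by
      ext x
      rw [Module.End.mul_apply, LinearMap.transvection.apply, map_add, map_smul, hp]
      simp only [Submodule.coe_add, Submodule.coe_smul, hA, compression_apply, hf,
        LinearEquiv.mul_apply, orthRefl_apply, map_sub, map_smul]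
      module
    rw [this, map_mul, LinearMap.transvection.det]

lemma det_compression_one {P : Submodule ℚ X} {Q : BilinForm ℚ X}
    (hP : ∀ x ∈ P, x ≠ 0 → 0 < Q x x)
    {π : X →ₗ[ℚ] X} (hπ : ∀ x, π x ∈ P) (hπ' : ∀ x, ∀ p ∈ P, Q (x - π x) p = 0) :
    LinearMap.det (compression P π hπ 1) = 1 := by
  have : compression P π hπ 1 = LinearMap.id := by
    ext x
    simp only [compression_apply, LinearEquiv.coe_one, id_eq, LinearMap.id_apply]
    by_contra hne
    have h1 : (x : X) - π x ≠ 0 := fun h => hne (sub_eq_zero.mp h).symm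
    have hmem : (x : X) - π x ∈ P := sub_mem x.2 (hπ _)
    have := hP _ hmem h1
    rw [hπ' _ _ hmem] at this
    exact lt_irrefl _ this
  rw [this, LinearMap.det_id]

lemma det_compression_neg_mul {P : Submodule ℚ X} (hP : Module.finrank ℚ P = 3)
    {π : X →ₗ[ℚ] X} (hπ : ∀ x, π x ∈ P) (h : X ≃ₗ[ℚ] X) :
    LinearMap.det (compression P π hπ (LinearEquiv.neg ℚ * h)) =
      -LinearMap.det (compression P π hπ h) := by
  have : compression P π hπ (LinearEquiv.neg ℚ * h) = (-1 : ℚ) • compression P π hπ h := by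
    ext x
    simp [compression_apply, LinearEquiv.mul_apply]
  rw [this, LinearMap.det_smul, hP]
  ring

end Orientation

section ProdForm

lemma prodForm_apply (B : BilinForm ℚ V) (d : ℤ) (p q : V × ℚ) :
    prodForm B d p q = B p.1 q.1 - (2 * (d : ℚ)) * (p.2 * q.2) := rfl

lemma prodForm_symm {B : BilinForm ℚ V} (hsymm : ∀ x y, B x y = B y x) (d : ℤ) (p q : V × ℚ) :
    prodForm B d p q = prodForm B d q p := by
  rw [prodForm_apply, prodForm_apply, hsymm]
  ring

lemma orthRefl_prodForm_apply (B : BilinForm ℚ V) (d : ℤ) (u a : V) (b : ℚ) :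
    orthRefl (prodForm B d) (u, 0) (a, b) = (orthRefl B u a, b) := by
  ext <;> simp [orthRefl_apply, prodForm_apply]

lemma orthRefl_prodForm_transvection_apply {B : BilinForm ℚ V} {d : ℤ} (hd : d ≠ 0) {e : V}
    (hee : B e e = 0) (a : V) (b : ℚ) :
    orthRefl (prodForm B d) ((d : ℚ) • e, 1) (a, b) =
      (a + ((B e a - 2 * b) * d) • e, B e a - b) := by
  have hd' : (d : ℚ) ≠ 0 := by exact_mod_cast hd
  have h : 2 * (d * B e a - 2 * d * b) / (-(2 * d)) = 2 * b - B e a := by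
    field_simp
    ring
  ext
  · simp [orthRefl_apply, prodForm_apply, hee, h]
    module
  · simp [orthRefl_apply, prodForm_apply, hee, h]
    ring

variable {B : BilinForm ℚ V} {d : ℤ} {e f : V} {H : Subgroup ((V × ℚ) ≃ₗ[ℚ] (V × ℚ))}

lemma exists_map_snd_eq_zero_of_ne (hsymm : ∀ x y, B x y = B y x)
    (hee : B e e = 0) (hff : B f f = 0) (hef : B e f = -1) (hd : d ≠ 0)
    (hH : ∀ u : V, orthRefl (prodForm B d) (u, 0) ∈ H)
    (hτ : orthRefl (prodForm B d) ((d : ℚ) • e, 1) ∈ H) {a : V} {b : ℚ} (hfa : B f a ≠ 0) :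
    ∃ g ∈ H, ∃ a' : V, g (a, b) = (a', 0) := by
  by_cases hb : b = 0
  · exact ⟨1, one_mem _, a, by simp [hb]⟩
  set r := b / B f a with hr
  have hr0 : r ≠ 0 := div_ne_zero hb hfa
  refine ⟨_, mul_mem hτ (hH (e - r • f)), orthRefl B (e - r • f) a +
    ((B e (orthRefl B (e - r • f) a) - 2 * b) * d) • e, ?_⟩
  rw [LinearEquiv.mul_apply, orthRefl_prodForm_apply,
    orthRefl_prodForm_transvection_apply hd hee]
  refine Prod.ext rfl ?_
  change B e (orthRefl B (e - r • f) a) - b = 0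
  have hfe : B f e = -1 := by rw [hsymm, hef]
  have hpp : B (e - r • f) (e - r • f) = 2 * r := by
    simp [hee, hff, hef, hfe]
    ring
  have hpa : B (e - r • f) a = B e a - b := by
    simp [hr, hfa]
  rw [orthRefl_apply, hpp, hpa]
  simp only [map_sub, map_smul, smul_eq_mul, hee, hef]
  field_simp
  ring

lemma exists_map_snd_eq_zero (hsymm : ∀ x y, B x y = B y x)
    (hnd : ∀ a, (∀ y, B a y = 0) → a = 0)
    (hee : B e e = 0) (hff : B f f = 0) (hef : B e f = -1) (hd : d ≠ 0)
    (hH : ∀ u : V, orthRefl (prodForm B d) (u, 0) ∈ H)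
    (hτ : orthRefl (prodForm B d) ((d : ℚ) • e, 1) ∈ H) (a : V) (b : ℚ) :
    ∃ g ∈ H, ∃ a' : V, g (a, b) = (a', 0) := by
  have hfe : B f e = -1 := by rw [hsymm, hef]
  by_cases hb : b = 0
  · exact ⟨1, one_mem _, a, by simp [hb]⟩
  by_cases hfa : B f a = 0
  swap
  · exact exists_map_snd_eq_zero_of_ne hsymm hee hff hef hd hH hτ hfa
  by_cases ha : a = 0
  · subst ha
    obtain ⟨g, hg, a', ha'⟩ := exists_map_snd_eq_zero_of_ne (a := 0 + ((B e 0 - 2 * b) * d) • e)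
      (b := B e 0 - b) hsymm hee hff hef hd hH hτ (by simp [hfe, hb, hd])
    exact ⟨_, mul_mem hg hτ, a', by
      rw [LinearEquiv.mul_apply, orthRefl_prodForm_transvection_apply hd hee, ha']⟩
  obtain ⟨y, hy⟩ : ∃ y, B y a + (B y f + 1) * B e a ≠ 0 := by
    by_cases hea : B e a = 0
    · by_contra! h
      refine ha (hnd a fun y => ?_)
      have := h y
      rwa [hea, mul_zero, add_zero, hsymm] at this
    · exact ⟨0, by simpa using hea⟩
  set m := B y f + 1 with hm
  set K := B y y + 2 * m * B y e with hK
  set p := y + m • e + ((K - 1) / 2) • f with hp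
  have hpf : B p f = -1 := by
    simp [hp, hff, hef, hm]
  have hpa : B p a ≠ 0 := by
    simpa [hp, hfa] using hy
  have hpp : B p p = 1 := by
    simp only [hp, map_add, map_smul, LinearMap.add_apply, LinearMap.smul_apply, smul_eq_mul,
      hee, hff, hef, hfe, hsymm e y, hsymm f y]
    rw [hK, hm]
    ring
  obtain ⟨g, hg, a', ha'⟩ := exists_map_snd_eq_zero_of_ne (a := orthRefl B p a) (b := b)
    hsymm hee hff hef hd hH hτ (by
      rw [orthRefl_apply, map_sub, map_smul, hfa, hpp, hsymm f p, hpf]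
      simpa using hpa)
  exact ⟨_, mul_mem hg (hH p), a', by
    rw [LinearEquiv.mul_apply, orthRefl_prodForm_apply, ha']⟩

/-- Every isometry of `V × ℚ` fixing `(0, 1)` is a product of reflections in vectors of `V`. -/
lemma mem_of_map_eq [FiniteDimensional ℚ V] (hsymm : ∀ x y, B x y = B y x)
    (hnd : ∀ a, (∀ y, B a y = 0) → a = 0) (hd : d ≠ 0)
    (hH : ∀ u : V, orthRefl (prodForm B d) (u, 0) ∈ H)
    {φ : (V × ℚ) ≃ₗ[ℚ] (V × ℚ)} (hφ : φ ∈ isomGroup (prodForm B d))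
    (hφ1 : φ (0, 1) = (0, 1)) (hHi : H ≤ isomGroup (prodForm B d)) : φ ∈ H := by
  have hQ := prodForm_symm hsymm d
  have hd' : (d : ℚ) ≠ 0 := by exact_mod_cast hd
  obtain ⟨b, hb⟩ := LinearMap.BilinForm.exists_orthogonal_basis (B := B) ⟨fun x y => hsymm x y⟩
  have hbo : ∀ i j, i ≠ j → B (b i) (b j) = 0 := fun i j hij => hb hij
  have hb0 : ∀ i, B (b i) (b i) ≠ 0 := by
    intro i hi
    refine b.ne_zero i (hnd _ fun y => ?_)
    have : B (b i) = 0 := by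
      refine b.ext fun j => ?_
      by_cases hij : i = j
      · subst hij
        exact hi
      · exact hbo i j hij
    rw [this, LinearMap.zero_apply]
  have key : ∀ s : Finset (Fin (Module.finrank ℚ V)), ∃ g ∈ H, g (φ (0, 1)) = (0, 1) ∧
      ∀ i ∈ s, g (φ (b i, 0)) = (b i, 0) := by
    intro s
    induction s using Finset.induction_on with
    | empty => exact ⟨1, one_mem _, hφ1, by simp⟩
    | insert j s hj ih =>
      obtain ⟨g, hg, hg1, hgs⟩ := ih
      have hi : ∀ x y, prodForm B d (g (φ x)) (g (φ y)) = prodForm B d x y := fun x y =>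
        (hHi hg _ _).trans (hφ _ _)
      have hsnd : (g (φ (b j, 0))).2 = 0 := by
        have := hi (b j, 0) (0, 1)
        rw [hg1] at this
        simpa [prodForm_apply, hd] using this
      obtain ⟨r, hr, hrj, hrz⟩ := exists_orthRefl_map hQ H (LinearMap.ker (LinearMap.snd ℚ V ℚ))
        (by
          rintro ⟨u, c⟩ hc
          obtain rfl : c = 0 := hc
          exact hH u)
        (x := g (φ (b j, 0))) (y := (b j, 0)) hsnd rfl (hi _ _)
        (by simpa [prodForm_apply] using hb0 j)
      refine ⟨r * g, mul_mem hr hg, ?_, ?_⟩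
      · rw [LinearEquiv.mul_apply, hg1]
        refine hrz _ ?_ ?_ <;> simp [prodForm_apply, hsnd]
      · intro i his
        rw [LinearEquiv.mul_apply]
        rcases Finset.mem_insert.mp his with rfl | his
        · exact hrj
        · have hij : j ≠ i := by
            rintro rfl
            exact hj his
          have h0 : prodForm B d (b j, 0) (b i, 0) = 0 := by
            simp [prodForm_apply, hbo j i hij]
          rw [hgs i his]
          refine hrz _ (Eq.trans ?_ h0) h0
          have := hi (b j, 0) (b i, 0)
          rwa [hgs i his] at this
  obtain ⟨g, hg, hg1, hgs⟩ := key Finset.univ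
  have hone : g * φ = 1 := by
    have hV : ((g * φ : (V × ℚ) ≃ₗ[ℚ] (V × ℚ)) : (V × ℚ) →ₗ[ℚ] (V × ℚ)) ∘ₗ
        LinearMap.inl ℚ V ℚ = LinearMap.inl ℚ V ℚ :=
      b.ext fun i => hgs i (Finset.mem_univ i)
    refine LinearEquiv.toLinearMap_injective (LinearMap.prod_ext hV ?_)
    ext
    · exact congrArg Prod.fst hg1
    · exact congrArg Prod.snd hg1
  rw [eq_inv_of_mul_eq_one_right hone]
  exact inv_mem hg

/-- The isometry group of `V × ℚ` is generated by the reflections in vectors of `V` together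
with the reflection in `(d e, 1)`. -/
lemma isomGroup_le [FiniteDimensional ℚ V] (hsymm : ∀ x y, B x y = B y x)
    (hnd : ∀ a, (∀ y, B a y = 0) → a = 0)
    (hee : B e e = 0) (hff : B f f = 0) (hef : B e f = -1) (hd : d ≠ 0)
    (hH : ∀ u : V, orthRefl (prodForm B d) (u, 0) ∈ H)
    (hτ : orthRefl (prodForm B d) ((d : ℚ) • e, 1) ∈ H)
    (hHi : H ≤ isomGroup (prodForm B d)) : isomGroup (prodForm B d) ≤ H := by
  intro φ hφ
  have hQ := prodForm_symm hsymm d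
  have hd' : (d : ℚ) ≠ 0 := by exact_mod_cast hd
  obtain ⟨g₁, hg₁, a₁, ha₁⟩ := exists_map_snd_eq_zero hsymm hnd hee hff hef hd hH hτ
    (φ (0, 1)).1 (φ (0, 1)).2
  obtain ⟨g₂, hg₂, a₂, ha₂⟩ := exists_map_snd_eq_zero hsymm hnd hee hff hef hd hH hτ 0 1
  have hn₁ : prodForm B d (a₁, 0) (a₁, 0) = prodForm B d (0, 1) (0, 1) := by
    rw [← ha₁]
    exact (hHi hg₁ _ _).trans (hφ _ _)
  have hn₂ : prodForm B d (a₂, 0) (a₂, 0) = prodForm B d (0, 1) (0, 1) := by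
    rw [← ha₂]
    exact hHi hg₂ _ _
  obtain ⟨r, hr, hr12, -⟩ := exists_orthRefl_map hQ H (LinearMap.ker (LinearMap.snd ℚ V ℚ))
    (by
      rintro ⟨u, c⟩ hc
      obtain rfl : c = 0 := hc
      exact hH u)
    (x := (a₁, 0)) (y := (a₂, 0)) rfl rfl (hn₁.trans hn₂.symm)
    (by
      rw [hn₂]
      simpa [prodForm_apply] using hd)
  have hg : g₂⁻¹ * r * g₁ ∈ H := mul_mem (mul_mem (inv_mem hg₂) hr) hg₁
  have h1 : (g₂⁻¹ * r * g₁ * φ) (0, 1) = (0, 1) := by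
    have h3 : g₁ (φ (0, 1)) = (a₁, 0) := ha₁
    simp only [LinearEquiv.mul_apply, h3, hr12]
    rw [← ha₂]
    exact g₂.symm_apply_apply _
  have h2 := mem_of_map_eq hsymm hnd hd hH (mul_mem (hHi hg) hφ) h1 hHi
  exact (H.mul_mem_cancel_left hg).mp h2

end ProdForm

section Signature

variable {B : BilinForm ℚ V}

lemma HasSignatureThree.eq_zero_of_forall {s : ℕ} (hsymm : ∀ x y, B x y = B y x)
    (hsig : HasSignatureThree B s) (a : V) (ha : ∀ y, B a y = 0) : a = 0 := by
  obtain ⟨P, N, hPN, hort, -, -, hP, hN⟩ := hsig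
  obtain ⟨p, hp, n, hn, rfl⟩ := Submodule.mem_sup.mp
    (hPN.sup_eq_top ▸ Submodule.mem_top : a ∈ P ⊔ N)
  have h1 := ha p
  have h2 := ha n
  rw [map_add, LinearMap.add_apply] at h1 h2
  rw [hsymm n p, hort p hp n hn, add_zero] at h1
  rw [hort p hp n hn, zero_add] at h2
  have hp0 : p = 0 := by
    by_contra h
    exact (hP p hp h).ne' h1
  have hn0 : n = 0 := by
    by_contra h
    exact (hN n hn h).ne h2
  rw [hp0, hn0, add_zero]

lemma HasSignatureThree.neg_of_orthogonal [FiniteDimensional ℚ V] {s : ℕ} {d : ℤ}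
    (hsymm : ∀ x y, B x y = B y x) (hd : 0 < d) (hsig : HasSignatureThree B s)
    {P : Submodule ℚ (V × ℚ)} (hP : IsPosDefThree (prodForm B d) P) (x : V × ℚ)
    (hx : ∀ p ∈ P, prodForm B d x p = 0) (hx0 : x ≠ 0) : prodForm B d x x < 0 := by
  obtain ⟨R, N, hRN, -, hR3, -, -, hN⟩ := hsig
  obtain ⟨hP3, hPpos⟩ := hP
  have hQ := prodForm_symm hsymm d
  by_contra! hxx
  have hxP : x ∉ P := fun h => (hPpos x h hx0).ne' (hx x h)
  have hlt : P < P ⊔ ℚ ∙ x := by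
    refine lt_of_le_of_ne le_sup_left fun h => hxP ?_
    rw [h]
    exact Submodule.mem_sup_right (Submodule.mem_span_singleton_self x)
  have hrank := Submodule.finrank_lt_finrank_of_lt hlt
  have hq : Module.finrank ℚ (V ⧸ N) = 3 := by
    have h1 := N.finrank_quotient_add_finrank
    have h2 := Submodule.finrank_add_eq_of_isCompl hRN
    omega
  let F : ↥(P ⊔ ℚ ∙ x) →ₗ[ℚ] V ⧸ N :=
    N.mkQ ∘ₗ LinearMap.fst ℚ V ℚ ∘ₗ (P ⊔ ℚ ∙ x).subtype
  have hF : LinearMap.ker F ≠ ⊥ := LinearMap.ker_ne_bot_of_finrank_lt (by omega)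
  obtain ⟨⟨m, hm⟩, hmF, hm0⟩ := Submodule.exists_mem_ne_zero_of_ne_bot hF
  have hmN : m.1 ∈ N := (Submodule.Quotient.mk_eq_zero N).mp hmF
  have hm0' : m ≠ 0 := fun h => hm0 (Subtype.ext h)
  obtain ⟨p, hp, y, hy, hpy⟩ := Submodule.mem_sup.mp hm
  obtain ⟨t, rfl⟩ := Submodule.mem_span_singleton.mp hy
  have h1 : 0 ≤ prodForm B d m m := by
    have e : prodForm B d m m = prodForm B d p p + t ^ 2 * prodForm B d x x := by
      rw [← hpy]
      simp only [map_add, map_smul, LinearMap.add_apply, LinearMap.smul_apply, smul_eq_mul,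
        hQ p x, hx p hp]
      ring
    have : 0 ≤ prodForm B d p p := by
      by_cases hp0 : p = 0
      · simp [hp0]
      · exact (hPpos p hp hp0).le
    rw [e]
    positivity
  have hd' : (0 : ℚ) < d := by exact_mod_cast hd
  rw [prodForm_apply] at h1
  have h2 : 0 ≤ 2 * (d : ℚ) * (m.2 * m.2) := mul_nonneg (by positivity) (mul_self_nonneg _)
  by_cases hm1 : m.1 = 0
  · have hm2 : m.2 ≠ 0 := fun h => hm0' (Prod.ext hm1 h)
    have h3 : 0 < 2 * (d : ℚ) * (m.2 * m.2) := mul_pos (by positivity) (mul_self_pos.mpr hm2)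
    rw [hm1, map_zero] at h1
    linarith
  · have := hN _ hmN hm1
    linarith

lemma HasSignatureThree.exists_pos_orthogonal {s : ℕ} (hsig : HasSignatureThree B s) (u c : V) :
    ∃ p, 0 < B p p ∧ B p u = 0 ∧ B p c = 0 := by
  obtain ⟨P, -, -, -, hP3, -, hP, -⟩ := hsig
  have : FiniteDimensional ℚ P := Module.finite_of_finrank_pos (by omega)
  let F : ↥P →ₗ[ℚ] ℚ × ℚ := ((B.flip u).prod (B.flip c)) ∘ₗ P.subtype
  have hF : LinearMap.ker F ≠ ⊥ := LinearMap.ker_ne_bot_of_finrank_lt (by simp [hP3])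
  obtain ⟨p, hpF, hp0⟩ := Submodule.exists_mem_ne_zero_of_ne_bot hF
  have h : F p = (0, 0) := hpF
  exact ⟨p, hP p p.2 fun h0 => hp0 (Subtype.ext h0), congrArg Prod.fst h, congrArg Prod.snd h⟩

/-- For negative vectors `u` and `c` there is a negative vector spanning an indefinite plane with
each of them. -/
lemma HasSignatureThree.exists_neg_indefinite {s : ℕ} (hsymm : ∀ x y, B x y = B y x)
    (hsig : HasSignatureThree B s) {u c : V} (hu : B u u < 0) (hc : B c c < 0) :
    ∃ v, B v v < 0 ∧ B u u * B v v < B u v ^ 2 ∧ B c c * B v v < B c v ^ 2 := by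
  obtain ⟨p, hp, hpu, hpc⟩ := hsig.exists_pos_orthogonal u c
  obtain ⟨m, hm, hum, hcm, hpm⟩ :
      ∃ m, B m m < 0 ∧ B u m ≠ 0 ∧ B c m ≠ 0 ∧ B p m = 0 := by
    by_cases h : B u c = 0
    · have h' : B c u = 0 := by rw [hsymm, h]
      exact ⟨u + c, by simp [h, h']; linarith, by simp [h, hu.ne], by simp [h', hc.ne],
        by simp [hpu, hpc]⟩
    · exact ⟨u, hu, hu.ne, by rwa [hsymm], hpu⟩
  have hM : 0 < -B m m := by linarith
  have hA : 0 < -B u u := by linarith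
  have hC : 0 < -B c c := by linarith
  set x := B p p / -B m m with hx
  have hx0 : 0 < x := div_pos hp hM
  have hxM : x * -B m m = B p p := div_mul_cancel₀ _ hM.ne'
  set ε := min (x * B u m ^ 2 / -B u u) (x * B c m ^ 2 / -B c c) with hε
  have hε0 : 0 < ε := lt_min (by positivity) (by positivity)
  obtain ⟨t, -, ht1, ht2⟩ := exists_rat_pow_btwn (n := 2) two_ne_zero
    (show x < x + ε / -B m m by linarith [div_pos hε0 hM]) (by positivity)
  rw [Rat.cast_id] at ht1 ht2
  have hvv : B (p + t • m) (p + t • m) = B p p - t ^ 2 * -B m m := by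
    simp [hpm, hsymm m p]
    ring
  have hlt : t ^ 2 * -B m m - B p p < ε := by
    have := mul_lt_mul_of_pos_right ht2 hM
    rw [add_mul, hxM, div_mul_cancel₀ _ hM.ne'] at this
    linarith
  have hgt : B p p < t ^ 2 * -B m m := hxM ▸ mul_lt_mul_of_pos_right ht1 hM
  have key : ∀ w, B p w = 0 → 0 < -B w w → B w m ≠ 0 → ε ≤ x * B w m ^ 2 / -B w w →
      B w w * B (p + t • m) (p + t • m) < B w (p + t • m) ^ 2 := by
    intro w hpw hw hwm hεw
    have h1 : B w (p + t • m) = t * B w m := by simp [hsymm w p, hpw]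
    rw [le_div_iff₀ hw] at hεw
    have h2 := mul_lt_mul_of_pos_right hlt hw
    have h3 : x * B w m ^ 2 < t ^ 2 * B w m ^ 2 := mul_lt_mul_of_pos_right ht1 (by positivity)
    rw [h1, hvv]
    nlinarith
  exact ⟨p + t • m, by rw [hvv]; linarith, key u hpu hA hum (min_le_left _ _),
    key c hpc hC hcm (min_le_right _ _)⟩

/-- A group containing the reflections in all positive vectors and in one negative vector of `V`
contains all reflections in vectors of `V`. -/
lemma HasSignatureThree.orthRefl_mem {s : ℕ} {d : ℤ} (hsymm : ∀ x y, B x y = B y x)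
    (hsig : HasSignatureThree B s) {H : Subgroup ((V × ℚ) ≃ₗ[ℚ] (V × ℚ))}
    (hpos : ∀ u, 0 < B u u → orthRefl (prodForm B d) (u, 0) ∈ H)
    {c : V} (hc : B c c < 0) (hcH : orthRefl (prodForm B d) (c, 0) ∈ H) (u : V) :
    orthRefl (prodForm B d) (u, 0) ∈ H := by
  have plane : ∀ x y, B x x < 0 → B y y < 0 → B x x * B y y < B x y ^ 2 →
      orthRefl (prodForm B d) (y, 0) ∈ H → orthRefl (prodForm B d) (x, 0) ∈ H := by
    intro x y hx hy hxy hyH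
    have h := orthRefl_mul_orthRefl_eq (Q := prodForm B d) (prodForm_symm hsymm d) (x := (x, 0))
      (y := (y, 0)) (by simpa [prodForm_apply] using hx.ne)
      (by simpa [prodForm_apply] using hy.ne)
      (by simpa [prodForm_apply] using (sub_neg.mpr hxy).ne)
    have e : ∀ p q : V, prodForm B d (p, 0) (q, 0) = B p q := fun p q => by
      simp [prodForm_apply]
    rw [e, e, e] at h
    have h1 : orthRefl (prodForm B d) (x, 0) * orthRefl (prodForm B d) (y, 0) ∈ H := by
      rw [h]
      refine mul_mem ?_ ?_
      · have := hpos (B x x • y - B x y • x) (by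
          have : B (B x x • y - B x y • x) (B x x • y - B x y • x) =
              -B x x * (B x y ^ 2 - B x x * B y y) := by
            simp [hsymm y x]
            ring
          rw [this]
          exact mul_pos (by linarith) (by linarith))
        simpa using this
      · have := hpos (B y y • x - B x y • y) (by
          have : B (B y y • x - B x y • y) (B y y • x - B x y • y) =
              -B y y * (B x y ^ 2 - B x x * B y y) := by
            simp [hsymm y x]
            ring
          rw [this]
          exact mul_pos (by linarith) (by linarith))
        simpa using this
    exact (H.mul_mem_cancel_right hyH).mp h1
  rcases lt_trichotomy (B u u) 0 with hu | hu | hu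
  · obtain ⟨v, hv, huv, hcv⟩ := hsig.exists_neg_indefinite hsymm hu hc
    refine plane u v hu hv huv (plane v c hv hc ?_ hcH)
    rwa [hsymm v c, mul_comm]
  · have : orthRefl (prodForm B d) (u, 0) = 1 := by
      ext x <;> simp [orthRefl_apply, prodForm_apply, hu]
    rw [this]
    exact one_mem _
  · exact hpos u hu

/-- Three orthogonal hyperbolic planes contain a positive-definite `3`-dimensional subspace. -/
lemma ContainsU3.exists_isPosDefThree {L : Submodule ℤ V} (hsymm : ∀ x y, B x y = B y x)
    (hU3 : ContainsU3 B L) (d : ℤ) :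
    ∃ P : Submodule ℚ (V × ℚ), IsPosDefThree (prodForm B d) P ∧
      ∃ π : (V × ℚ) →ₗ[ℚ] (V × ℚ), (∀ x, π x ∈ P) ∧
        ∀ x, ∀ p ∈ P, prodForm B d (x - π x) p = 0 := by
  obtain ⟨e, f, -, -, hee, hff, hef⟩ := hU3
  have hQ := prodForm_symm hsymm d
  have hfe : ∀ i j, B (f i) (e j) = if j = i then -1 else 0 := fun i j => by rw [hsymm, hef]
  let g : Fin 3 → V × ℚ := fun i => (e i - f i, 0)
  have hg : ∀ i j, prodForm B d (g i) (g j) = if i = j then 2 else 0 := by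
    intro i j
    by_cases hij : i = j
    · simp [g, prodForm_apply, hee, hff, hef, hfe, hij]
      norm_num
    · simp [g, prodForm_apply, hee, hff, hef, hfe, hij, Ne.symm hij]
  let F : (Fin 3 → ℚ) →ₗ[ℚ] (V × ℚ) := Fintype.linearCombination ℚ g
  have hF : ∀ c, F c = ∑ i, c i • g i := fun c => Fintype.linearCombination_apply ℚ g c
  have hFg : ∀ c j, prodForm B d (F c) (g j) = 2 * c j := by
    intro c j
    simp [hF, hg]
    ring
  have hFF : ∀ c, prodForm B d (F c) (F c) = ∑ i, 2 * c i ^ 2 := by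
    intro c
    conv_lhs => rw [hF c, ← hF c]
    rw [show prodForm B d (F c) (F c) = ∑ i, c i * prodForm B d (F c) (g i) by
      conv_lhs => arg 2; rw [hF c]
      simp]
    refine Finset.sum_congr rfl fun i _ => ?_
    rw [hFg]
    ring
  have hinj : Function.Injective F := by
    rw [injective_iff_map_eq_zero]
    intro c hc
    ext j
    have := hFg c j
    rw [hc] at this
    simpa using this.symm
  refine ⟨LinearMap.range F, ⟨?_, ?_⟩,
    F ∘ₗ LinearMap.pi fun i => (1 / 2 : ℚ) • prodForm B d (g i), fun x => ⟨_, rfl⟩, ?_⟩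
  · rw [LinearMap.finrank_range_of_inj hinj]
    simp
  · rintro _ ⟨c, rfl⟩ hc
    rw [hFF]
    obtain ⟨j, hj⟩ : ∃ j, c j ≠ 0 := by
      by_contra! h
      exact hc (by rw [show c = 0 from funext h, map_zero])
    exact Finset.sum_pos' (fun i _ => by positivity) ⟨j, Finset.mem_univ j, by positivity⟩
  · rintro x _ ⟨c, rfl⟩
    rw [hF c, map_sum]
    refine Finset.sum_eq_zero fun j _ => ?_
    rw [map_smul, map_sub, LinearMap.sub_apply, LinearMap.comp_apply, hFg, hQ x]
    simp

end Signature

section Gamma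

variable {B : BilinForm ℚ V} {L : Submodule ℤ V} {d : ℤ}

lemma mem_intLat {q : ℚ} : q ∈ intLat ↔ ∃ n : ℤ, q = n := by
  rw [intLat, Submodule.mem_span_singleton]
  refine exists_congr fun n => ?_
  rw [zsmul_eq_mul, mul_one, eq_comm]

lemma intCast_smul_mem {x : V} (hx : x ∈ L) (n : ℤ) : (n : ℚ) • x ∈ L := by
  rw [Int.cast_smul_eq_zsmul]
  exact L.smul_mem n hx

lemma preservesLattice_orthRefl {X : Type*} [AddCommGroup X] [Module ℚ X] {Q : BilinForm ℚ X}
    {M : Submodule ℤ X} {v : X} (h : ∀ x ∈ M, orthRefl Q v x ∈ M) :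
    PreservesLattice M (orthRefl Q v) :=
  ⟨h, h⟩

lemma fst_mem_of_mem_dualLattice (hunimod : dualLattice B L = L) {x : V × ℚ}
    (hx : x ∈ dualLattice (prodForm B d) (L.prod intLat)) : x.1 ∈ L := by
  rw [← hunimod]
  intro y hy
  obtain ⟨n, hn⟩ := hx (y, 0) ⟨hy, zero_mem _⟩
  exact ⟨n, by simpa [prodForm_apply] using hn⟩

lemma exists_int_of_mem_dualLattice {x : V × ℚ}
    (hx : x ∈ dualLattice (prodForm B d) (L.prod intLat)) : ∃ n : ℤ, 2 * (d : ℚ) * x.2 = n := by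
  obtain ⟨n, hn⟩ := hx (0, 1) ⟨zero_mem _, mem_intLat.mpr ⟨1, by simp⟩⟩
  refine ⟨-n, ?_⟩
  rw [prodForm_apply, map_zero, mul_one, zero_sub] at hn
  push_cast
  linarith

lemma orientPos_one (hP : ∃ P : Submodule ℚ (V × ℚ), IsPosDefThree (prodForm B d) P ∧
      ∃ π : (V × ℚ) →ₗ[ℚ] (V × ℚ), (∀ x, π x ∈ P) ∧
        ∀ x, ∀ p ∈ P, prodForm B d (x - π x) p = 0) : OrientPos (prodForm B d) 1 := by
  obtain ⟨P, hP, π, hπ, hπ'⟩ := hP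
  refine ⟨P, hP, π, hπ, hπ', compression P π hπ 1, fun x => rfl, ?_⟩
  rw [det_compression_one hP.2 hπ hπ']
  exact one_pos

lemma orientPos_orthRefl [FiniteDimensional ℚ V] {s : ℕ} (hsymm : ∀ x y, B x y = B y x)
    (hd : 0 < d) (hsig : HasSignatureThree B s)
    (hP : ∃ P : Submodule ℚ (V × ℚ), IsPosDefThree (prodForm B d) P ∧
      ∃ π : (V × ℚ) →ₗ[ℚ] (V × ℚ), (∀ x, π x ∈ P) ∧
        ∀ x, ∀ p ∈ P, prodForm B d (x - π x) p = 0)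
    {v : V × ℚ} (hv : prodForm B d v v < 0) :
    OrientPos (prodForm B d) (orthRefl (prodForm B d) v) := by
  obtain ⟨P, hP, π, hπ, hπ'⟩ := hP
  refine ⟨P, hP, π, hπ, hπ', compression P π hπ (orthRefl (prodForm B d) v),
    fun x => rfl, ?_⟩
  have h1 := det_compression_one hP.2 hπ hπ'
  obtain ⟨c, hc, hdet⟩ := det_compression_orthRefl_mul (prodForm_symm hsymm d) hP.2
    (hsig.neg_of_orthogonal hsymm hd hP) hπ hπ' (one_mem _) (by rw [h1]; exact one_ne_zero) hv.ne
  rw [mul_one, h1, one_mul] at hdet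
  rw [hdet]
  exact pos_of_mul_neg_left hc hv.le

/-- The reflection in a vector of `L` of norm `-2` lies in `Γ`. -/
lemma inGamma_orthRefl (hsymm : ∀ x y, B x y = B y x)
    (hint : ∀ x ∈ L, ∀ y ∈ L, ∃ n : ℤ, B x y = (n : ℚ))
    (hunimod : dualLattice B L = L) {c : V} (hc : c ∈ L) (hcc : B c c = -2)
    (hor : OrientPos (prodForm B d) (orthRefl (prodForm B d) (c, 0))) :
    InGamma (prodForm B d) (L.prod intLat) (orthRefl (prodForm B d) (c, 0)) := by
  have happ : ∀ x : V × ℚ, orthRefl (prodForm B d) (c, 0) x = x + (B c x.1 • c, 0) := by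
    rintro ⟨a, b⟩
    rw [orthRefl_prodForm_apply, orthRefl_apply, hcc]
    ext
    · simp
      module
    · simp
  have hmem : ∀ x : V × ℚ, x.1 ∈ L → ((B c x.1 • c, 0) : V × ℚ) ∈ L.prod intLat := by
    intro x hx
    obtain ⟨n, hn⟩ := hint c hc x.1 hx
    rw [hn]
    exact ⟨intCast_smul_mem hc n, zero_mem _⟩
  refine ⟨orthRefl_mem_isomGroup (prodForm_symm hsymm d) _, preservesLattice_orthRefl ?_, hor,
    Or.inl ?_⟩
  · intro x hx
    rw [happ]
    exact add_mem hx (hmem x hx.1)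
  · intro x hx
    rw [happ, add_sub_cancel_left]
    exact hmem x (fst_mem_of_mem_dualLattice hunimod hx)

/-- The reflection in `d e + δ`, for an isotropic vector `e` of `L`, lies in `Γ`; it acts as `-1`
on the discriminant group. -/
lemma inGamma_orthRefl_transvection (hsymm : ∀ x y, B x y = B y x)
    (hint : ∀ x ∈ L, ∀ y ∈ L, ∃ n : ℤ, B x y = (n : ℚ))
    (hunimod : dualLattice B L = L) (hd : d ≠ 0) {e : V} (he : e ∈ L) (hee : B e e = 0)
    (hor : OrientPos (prodForm B d) (orthRefl (prodForm B d) ((d : ℚ) • e, 1))) :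
    InGamma (prodForm B d) (L.prod intLat) (orthRefl (prodForm B d) ((d : ℚ) • e, 1)) := by
  refine ⟨orthRefl_mem_isomGroup (prodForm_symm hsymm d) _, preservesLattice_orthRefl ?_, hor,
    Or.inr ?_⟩
  · rintro ⟨a, b⟩ ⟨ha, hb⟩
    obtain ⟨n, hn⟩ := hint e he a ha
    obtain ⟨m, rfl⟩ := mem_intLat.mp hb
    rw [orthRefl_prodForm_transvection_apply hd hee, hn]
    refine ⟨add_mem ha ?_, mem_intLat.mpr ⟨n - m, by push_cast; rfl⟩⟩
    have := intCast_smul_mem he ((n - 2 * m) * d)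
    push_cast at this
    exact this
  · rintro ⟨a, b⟩ hx
    have ha : a ∈ L := fst_mem_of_mem_dualLattice hunimod hx
    obtain ⟨k, hk⟩ := exists_int_of_mem_dualLattice hx
    obtain ⟨n, hn⟩ := hint e he a ha
    rw [orthRefl_prodForm_transvection_apply hd hee, hn]
    refine ⟨add_mem (add_mem ha ?_) ha, mem_intLat.mpr ⟨n, by simp⟩⟩
    have := intCast_smul_mem he (n * d - k)
    push_cast at this
    rwa [← hk, show (n : ℚ) * d - 2 * d * b = (n - 2 * b) * d by ring] at this

lemma exists_nsmul_mem (hfull : Submodule.span ℚ (L : Set V) = ⊤) (x : V) :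
    ∃ n : ℕ, n ≠ 0 ∧ (n : ℚ) • x ∈ L := by
  have hx : x ∈ Submodule.span ℚ (L : Set V) := hfull ▸ Submodule.mem_top
  induction hx using Submodule.span_induction with
  | mem x hx => exact ⟨1, one_ne_zero, by simpa using hx⟩
  | zero => exact ⟨1, one_ne_zero, by simp⟩
  | add x y _ _ hx hy =>
    obtain ⟨m, hm, hmx⟩ := hx
    obtain ⟨n, hn, hny⟩ := hy
    refine ⟨m * n, mul_ne_zero hm hn, ?_⟩
    have h1 := add_mem (intCast_smul_mem hmx n) (intCast_smul_mem hny m)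
    convert h1 using 1
    push_cast
    module
  | smul q x _ hx =>
    obtain ⟨m, hm, hmx⟩ := hx
    refine ⟨m * q.den, mul_ne_zero hm q.den_nz, ?_⟩
    have h1 := intCast_smul_mem hmx q.num
    convert h1 using 1
    rw [smul_smul, smul_smul]
    congr 1
    push_cast
    rw [mul_assoc, Rat.den_mul_eq_num, mul_comm]

/-- `φ` is a product `(-1)^k γ_k ρ_{u_k} ⋯ γ_1 ρ_{u_1} γ_0`. -/
def IsDecomposition (B : BilinForm ℚ V) (L : Submodule ℤ V) (d : ℤ) (k : ℕ)
    (φ : (V × ℚ) ≃ₗ[ℚ] (V × ℚ)) : Prop :=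
  ∃ (u : Fin k → V) (ρ : Fin k → ((V × ℚ) ≃ₗ[ℚ] (V × ℚ)))
    (γ : Fin (k + 1) → ((V × ℚ) ≃ₗ[ℚ] (V × ℚ))),
    (∀ i, u i ∈ L) ∧
    (∀ i, 2 ≤ B (u i) (u i)) ∧
    (∀ i, ∀ x : V × ℚ, ρ i x = x -
      (2 * prodForm B d (u i, (0 : ℚ)) x /
        prodForm B d (u i, (0 : ℚ)) (u i, (0 : ℚ))) • ((u i, (0 : ℚ)) : V × ℚ)) ∧
    (∀ i, InGamma (prodForm B d) (L.prod intLat) (γ i)) ∧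
    ∀ x : V × ℚ, φ x = ((-1 : ℚ)) ^ k •
      ((((List.ofFn fun i : Fin k => γ i.succ * ρ i).reverse.prod * γ 0) x))

lemma isDecomposition_zero {γ : (V × ℚ) ≃ₗ[ℚ] (V × ℚ)}
    (hγ : InGamma (prodForm B d) (L.prod intLat) γ) : IsDecomposition B L d 0 γ :=
  ⟨Fin.elim0, Fin.elim0, fun _ => γ, fun i => i.elim0, fun i => i.elim0, fun i => i.elim0,
    fun _ => hγ, fun x => by simp⟩

lemma IsDecomposition.succ {k : ℕ} {φ γ : (V × ℚ) ≃ₗ[ℚ] (V × ℚ)}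
    (hφ : IsDecomposition B L d k φ) (hγ : InGamma (prodForm B d) (L.prod intLat) γ)
    {u : V} (hu : u ∈ L) (huu : 2 ≤ B u u) :
    IsDecomposition B L d (k + 1)
      (γ * (LinearEquiv.neg ℚ * orthRefl (prodForm B d) (u, 0)) * φ) := by
  obtain ⟨us, ρs, γs, hus, huus, hρ, hγs, h⟩ := hφ
  refine ⟨Fin.snoc us u, Fin.snoc ρs (orthRefl (prodForm B d) (u, 0)), Fin.snoc γs γ,
    ?_, ?_, ?_, ?_, ?_⟩
  · refine Fin.lastCases ?_ fun i => ?_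
    · simpa using hu
    · simpa using hus i
  · refine Fin.lastCases ?_ fun i => ?_
    · simpa using huu
    · simpa using huus i
  · refine Fin.lastCases ?_ fun i => ?_
    · simp only [Fin.snoc_last]
      exact fun x => rfl
    · simpa only [Fin.snoc_castSucc] using hρ i
  · refine Fin.lastCases ?_ fun i => ?_
    · simpa using hγ
    · simpa using hγs i
  · intro x
    rw [List.ofFn_succ', List.concat_eq_append, List.reverse_append]
    simp only [Fin.succ_last, Fin.snoc_last, Fin.succ_castSucc, Fin.snoc_castSucc,
      List.reverse_singleton, List.singleton_append, List.prod_cons]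
    rw [show (Fin.snoc γs γ : Fin (k + 1 + 1) → ((V × ℚ) ≃ₗ[ℚ] (V × ℚ))) 0 = γs 0 from
      Fin.snoc_castSucc (α := fun _ => (V × ℚ) ≃ₗ[ℚ] (V × ℚ)) γ γs 0]
    simp only [LinearEquiv.mul_apply, h, LinearEquiv.neg_apply, map_smul, map_neg, pow_succ,
      mul_neg, mul_one, neg_smul, smul_neg]

end Gamma

section Decomposition

variable {B : BilinForm ℚ V} {L : Submodule ℤ V} {d : ℤ}

lemma neg_linearEquiv_mul_comm {X : Type*} [AddCommGroup X] [Module ℚ X] (g : X ≃ₗ[ℚ] X) :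
    LinearEquiv.neg ℚ * g = g * LinearEquiv.neg ℚ :=
  LinearEquiv.ext fun x => (map_neg g x).symm

lemma neg_linearEquiv_mul_cancel {X : Type*} [AddCommGroup X] [Module ℚ X] (g : X ≃ₗ[ℚ] X) :
    LinearEquiv.neg ℚ * (LinearEquiv.neg ℚ * g) = g :=
  LinearEquiv.ext fun x => neg_neg (g x)

/-- The negatives of reflections in vectors of `L` of norm at least `2`, together with the
reflections in vectors of negative norm that lie in `Γ`. -/
def signedReflections (B : BilinForm ℚ V) (L : Submodule ℤ V) (d : ℤ) :
    Set ((V × ℚ) ≃ₗ[ℚ] (V × ℚ)) :=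
  {g | ∃ u ∈ L, 2 ≤ B u u ∧ g = LinearEquiv.neg ℚ * orthRefl (prodForm B d) (u, 0)} ∪
    {g | ∃ v, prodForm B d v v < 0 ∧
      InGamma (prodForm B d) (L.prod intLat) (orthRefl (prodForm B d) v) ∧
      g = orthRefl (prodForm B d) v}

lemma inv_mem_signedReflections {g : (V × ℚ) ≃ₗ[ℚ] (V × ℚ)} (hg : g ∈ signedReflections B L d) :
    g⁻¹ = g := by
  rcases hg with ⟨u, -, -, rfl⟩ | ⟨v, -, -, rfl⟩
  · rw [mul_inv_rev, neg_linearEquiv_mul_comm]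
    rfl
  · exact orthRefl_inv _ _

lemma neg_mul_mem_isomGroup {X : Type*} [AddCommGroup X] [Module ℚ X] {Q : BilinForm ℚ X}
    {g : X ≃ₗ[ℚ] X} (hg : g ∈ isomGroup Q) : LinearEquiv.neg ℚ * g ∈ isomGroup Q := by
  intro x y
  rw [← hg x y]
  simp [LinearEquiv.mul_apply]

lemma closure_signedReflections_le (hsymm : ∀ x y, B x y = B y x) :
    Subgroup.closure (signedReflections B L d) ≤ isomGroup (prodForm B d) := by
  rw [Subgroup.closure_le]
  rintro g (⟨u, -, -, rfl⟩ | ⟨v, -, -, rfl⟩)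
  · exact neg_mul_mem_isomGroup (orthRefl_mem_isomGroup (prodForm_symm hsymm d) _)
  · exact orthRefl_mem_isomGroup (prodForm_symm hsymm d) _

/-- An induction principle for the group generated by `signedReflections`. -/
lemma closure_signedReflections_induction {p : ((V × ℚ) ≃ₗ[ℚ] (V × ℚ)) → Prop} (one : p 1)
    (mul : ∀ g ∈ signedReflections B L d, ∀ h ∈ Subgroup.closure (signedReflections B L d),
      p h → p (g * h)) {g : (V × ℚ) ≃ₗ[ℚ] (V × ℚ)}
    (hg : g ∈ Subgroup.closure (signedReflections B L d)) : p g := by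
  induction hg using Subgroup.closure_induction_left with
  | one => exact one
  | mul_left x hx y hy ih => exact mul x hx y hy ih
  | inv_mul_cancel x hx y hy ih =>
    rw [inv_mem_signedReflections hx]
    exact mul x hx y hy ih

lemma det_compression_pos [FiniteDimensional ℚ V] {s : ℕ} (hsymm : ∀ x y, B x y = B y x)
    (hd : 0 < d) (hsig : HasSignatureThree B s) {P : Submodule ℚ (V × ℚ)}
    (hP : IsPosDefThree (prodForm B d) P) {π : (V × ℚ) →ₗ[ℚ] (V × ℚ)} (hπ : ∀ x, π x ∈ P)
    (hπ' : ∀ x, ∀ p ∈ P, prodForm B d (x - π x) p = 0) {g : (V × ℚ) ≃ₗ[ℚ] (V × ℚ)}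
    (hg : g ∈ Subgroup.closure (signedReflections B L d)) :
    0 < LinearMap.det (compression P π hπ g) := by
  have hmul : ∀ v, prodForm B d v v ≠ 0 →
      ∀ h ∈ Subgroup.closure (signedReflections B L d),
      0 < LinearMap.det (compression P π hπ h) →
      ∃ c : ℚ, c * prodForm B d v v < 0 ∧
        LinearMap.det (compression P π hπ (orthRefl (prodForm B d) v * h)) =
          LinearMap.det (compression P π hπ h) * c := fun v hv h hh hdet =>
    det_compression_orthRefl_mul (prodForm_symm hsymm d) hP.2
      (hsig.neg_of_orthogonal hsymm hd hP) hπ hπ' (closure_signedReflections_le hsymm hh)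
      hdet.ne' hv
  refine closure_signedReflections_induction
    (p := fun g => 0 < LinearMap.det (compression P π hπ g)) ?_ (fun g hg h hh ih => ?_) hg
  · rw [det_compression_one hP.2 hπ hπ']
    exact one_pos
  · rcases hg with ⟨u, -, huu, rfl⟩ | ⟨v, hv, -, rfl⟩
    · have hu : 0 < prodForm B d (u, 0) (u, 0) := by
        simp only [prodForm_apply, mul_zero, sub_zero]
        linarith
      obtain ⟨c, hc, hdet⟩ := hmul _ hu.ne' h hh ih
      rw [mul_assoc, det_compression_neg_mul hP.1, hdet, ← mul_neg]
      exact mul_pos ih (neg_pos.mpr (neg_of_mul_neg_left hc hu.le))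
    · obtain ⟨c, hc, hdet⟩ := hmul _ hv.ne h hh ih
      rw [hdet]
      exact mul_pos ih (pos_of_mul_neg_left hc hv.le)

/-- The isometries that are, up to sign, products of `signedReflections`. -/
def signedClosure (B : BilinForm ℚ V) (L : Submodule ℤ V) (d : ℤ) :
    Subgroup ((V × ℚ) ≃ₗ[ℚ] (V × ℚ)) where
  carrier := {g | g ∈ Subgroup.closure (signedReflections B L d) ∨
    LinearEquiv.neg ℚ * g ∈ Subgroup.closure (signedReflections B L d)}
  one_mem' := Or.inl (one_mem _)
  mul_mem' := by
    rintro a b (ha | ha) (hb | hb)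
    · exact Or.inl (mul_mem ha hb)
    · refine Or.inr ?_
      rw [← mul_assoc, neg_linearEquiv_mul_comm, mul_assoc]
      exact mul_mem ha hb
    · refine Or.inr ?_
      rw [← mul_assoc]
      exact mul_mem ha hb
    · refine Or.inl ?_
      have h := mul_mem ha hb
      rwa [neg_linearEquiv_mul_comm a, mul_assoc, neg_linearEquiv_mul_cancel] at h
  inv_mem' := by
    rintro a (ha | ha)
    · exact Or.inl (inv_mem ha)
    · refine Or.inr ?_
      have h := inv_mem ha
      rw [mul_inv_rev] at h
      rw [neg_linearEquiv_mul_comm]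
      exact h

lemma signedClosure_le (hsymm : ∀ x y, B x y = B y x) :
    signedClosure B L d ≤ isomGroup (prodForm B d) := by
  rintro g (hg | hg)
  · exact closure_signedReflections_le hsymm hg
  · have h := neg_mul_mem_isomGroup (closure_signedReflections_le hsymm hg)
    rwa [neg_linearEquiv_mul_cancel] at h

lemma orthRefl_mem_signedClosure (hfull : Submodule.span ℚ (L : Set V) = ⊤)
    (heven : ∀ x ∈ L, ∃ n : ℤ, B x x = 2 * (n : ℚ)) {u : V} (hu : 0 < B u u) :
    orthRefl (prodForm B d) (u, 0) ∈ signedClosure B L d := by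
  obtain ⟨n, hn, hnu⟩ := exists_nsmul_mem hfull u
  have hn' : (n : ℚ) ≠ 0 := by exact_mod_cast hn
  refine Or.inr (Subgroup.subset_closure (Or.inl ⟨(n : ℚ) • u, hnu, ?_, ?_⟩))
  · obtain ⟨m, hm⟩ := heven _ hnu
    have hpos : 0 < B ((n : ℚ) • u) ((n : ℚ) • u) := by
      simp only [map_smul, LinearMap.smul_apply, smul_eq_mul]
      positivity
    rw [hm] at hpos ⊢
    have h1 : 0 < m := by exact_mod_cast pos_of_mul_pos_right hpos zero_le_two
    have h2 : (1 : ℚ) ≤ m := by exact_mod_cast h1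
    linarith
  · rw [← orthRefl_smul (prodForm B d) hn' (u, 0), Prod.smul_mk, smul_zero]

/-- Every isometry of `Λ_ℚ` is, up to sign, a product of `signedReflections`. -/
lemma isomGroup_le_signedClosure [FiniteDimensional ℚ V] {s : ℕ}
    (hsymm : ∀ x y, B x y = B y x) (hfull : Submodule.span ℚ (L : Set V) = ⊤)
    (hint : ∀ x ∈ L, ∀ y ∈ L, ∃ n : ℤ, B x y = (n : ℚ))
    (heven : ∀ x ∈ L, ∃ n : ℤ, B x x = 2 * (n : ℚ)) (hunimod : dualLattice B L = L)
    (hsig : HasSignatureThree B s) (hU3 : ContainsU3 B L) (hd : 0 < d) :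
    isomGroup (prodForm B d) ≤ signedClosure B L d := by
  have hP := hU3.exists_isPosDefThree hsymm d
  obtain ⟨e, f, he, hf, hee, hff, hef⟩ := hU3
  have hef0 : B (e 0) (f 0) = -1 := by simpa using hef 0 0
  have hdQ : (0 : ℚ) < d := by exact_mod_cast hd
  have hc : B (e 0 + f 0) (e 0 + f 0) = -2 := by
    simp only [map_add, LinearMap.add_apply, hee, hff, hsymm (f 0) (e 0), hef0]
    norm_num
  have hcneg : prodForm B d (e 0 + f 0, 0) (e 0 + f 0, 0) < 0 := by
    simp [prodForm_apply, -map_add, -LinearMap.add_apply, hc]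
  have htneg : prodForm B d ((d : ℚ) • e 0, 1) ((d : ℚ) • e 0, 1) < 0 := by
    simp [prodForm_apply, hee, hdQ]
  refine isomGroup_le hsymm (hsig.eq_zero_of_forall hsymm) (hee 0 0) (hff 0 0) hef0 hd.ne'
    (hsig.orthRefl_mem hsymm (fun u hu => orthRefl_mem_signedClosure hfull heven hu)
      (c := e 0 + f 0) (by rw [hc]; norm_num) ?_) ?_ (signedClosure_le hsymm)
  · exact Or.inl (Subgroup.subset_closure (Or.inr ⟨_, hcneg,
      inGamma_orthRefl hsymm hint hunimod (add_mem (he 0) (hf 0)) hc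
        (orientPos_orthRefl hsymm hd hsig hP hcneg), rfl⟩))
  · exact Or.inl (Subgroup.subset_closure (Or.inr ⟨_, htneg,
      inGamma_orthRefl_transvection hsymm hint hunimod hd.ne' (he 0) (hee 0 0)
        (orientPos_orthRefl hsymm hd hsig hP htneg), rfl⟩))

lemma inGamma_one {Q : BilinForm ℚ V} {M : Submodule ℤ V} (h : OrientPos Q 1) :
    InGamma Q M 1 :=
  ⟨one_mem _, ⟨fun _ hx => hx, fun _ hx => hx⟩, h, Or.inl fun x _ => by simp⟩

/-- A decomposition of length `k` can be lengthened by two factors with cancelling reflections. -/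
lemma IsDecomposition.add_two {k : ℕ} {φ γ : (V × ℚ) ≃ₗ[ℚ] (V × ℚ)}
    (hφ : IsDecomposition B L d k φ) (hγ : InGamma (prodForm B d) (L.prod intLat) γ)
    (h1 : InGamma (prodForm B d) (L.prod intLat) 1) {u : V} (hu : u ∈ L) (huu : 2 ≤ B u u) :
    IsDecomposition B L d (k + 2) (γ * φ) := by
  have h : γ * (LinearEquiv.neg ℚ * orthRefl (prodForm B d) (u, 0)) *
      (1 * (LinearEquiv.neg ℚ * orthRefl (prodForm B d) (u, 0)) * φ) = γ * φ :=
    LinearEquiv.ext fun x => by simp [LinearEquiv.mul_apply, orthRefl_refl]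
  exact h ▸ (hφ.succ h1 hu huu).succ hγ hu huu

lemma exists_isDecomposition (h1 : InGamma (prodForm B d) (L.prod intLat) 1) {u : V}
    (hu : u ∈ L) (huu : 2 ≤ B u u) {g : (V × ℚ) ≃ₗ[ℚ] (V × ℚ)}
    (hg : g ∈ Subgroup.closure (signedReflections B L d)) :
    ∃ k, IsDecomposition B L d k g := by
  refine closure_signedReflections_induction (p := fun g => ∃ k, IsDecomposition B L d k g)
    ⟨0, isDecomposition_zero h1⟩ (fun g hg h _ ih => ?_) hg
  · obtain ⟨k, hk⟩ := ih
    rcases hg with ⟨w, hw, hww, rfl⟩ | ⟨v, -, hγ, rfl⟩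
    · exact ⟨k + 1, by simpa only [one_mul] using hk.succ h1 hw hww⟩
    · exact ⟨k + 2, hk.add_two hγ h1 hu huu⟩

end Decomposition

/-- Every `φ ∈ O⁺(Λ_ℚ)` decomposes as
`φ = (−1)^k · γ_k ρ_{u_k} γ_{k−1} ρ_{u_{k−1}} ⋯ γ_1 ρ_1 γ_0`, with `k ≥ 1`, `u_i ∈ L`
satisfying `(u_i, u_i) ≥ 2`, `ρ_{u_i}` the reflection of `Λ_ℚ` in `u_i^⊥`, and `γ_i ∈ Γ`. -/
theorem statement4
    {V : Type*} [AddCommGroup V] [Module ℚ V] [FiniteDimensional ℚ V]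
    (B : BilinForm ℚ V) (L : Submodule ℤ V) (d : ℤ)
    (hsymm : ∀ x y, B x y = B y x)
    (hfull : Submodule.span ℚ (L : Set V) = ⊤)
    (hfg : L.FG)
    (hint : ∀ x ∈ L, ∀ y ∈ L, ∃ n : ℤ, B x y = (n : ℚ))
    (heven : ∀ x ∈ L, ∃ n : ℤ, B x x = 2 * (n : ℚ))
    (hunimod : dualLattice B L = L)
    (sminus : ℕ) (hs : 3 ≤ sminus) (hsig : HasSignatureThree B sminus)
    (hU3 : ContainsU3 B L)
    (hd : 0 < d)
    (φ : (V × ℚ) ≃ₗ[ℚ] (V × ℚ))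
    (hφ : φ ∈ isomGroup (prodForm B d))
    (hφpos : OrientPos (prodForm B d) φ) :
    ∃ k : ℕ, 0 < k ∧
      ∃ (u : Fin k → V) (ρ : Fin k → ((V × ℚ) ≃ₗ[ℚ] (V × ℚ)))
        (γ : Fin (k + 1) → ((V × ℚ) ≃ₗ[ℚ] (V × ℚ))),
        (∀ i, u i ∈ L) ∧
        (∀ i, 2 ≤ B (u i) (u i)) ∧
        (∀ i, ∀ x : V × ℚ, ρ i x = x -
          (2 * prodForm B d (u i, (0 : ℚ)) x /
            prodForm B d (u i, (0 : ℚ)) (u i, (0 : ℚ))) • ((u i, (0 : ℚ)) : V × ℚ)) ∧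
        (∀ i, InGamma (prodForm B d) (L.prod intLat) (γ i)) ∧
        ∀ x : V × ℚ, φ x = ((-1 : ℚ)) ^ k •
          ((((List.ofFn fun i : Fin k => γ i.succ * ρ i).reverse.prod * γ 0) x)) := by
  obtain ⟨P, hP, π, hπ, hπ', q, hq, hdet⟩ := hφpos
  have hqφ : q = compression P π hπ φ := LinearMap.ext fun x => Subtype.ext (hq x)
  have hφG : φ ∈ Subgroup.closure (signedReflections B L d) := by
    refine (isomGroup_le_signedClosure hsymm hfull hint heven hunimod hsig hU3 hd hφ).resolve_right
      fun h => ?_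
    have h2 := det_compression_pos hsymm hd hsig hP hπ hπ' h
    rw [det_compression_neg_mul hP.1, ← hqφ] at h2
    linarith
  have h1 : InGamma (prodForm B d) (L.prod intLat) 1 :=
    inGamma_one (orientPos_one (hU3.exists_isPosDefThree hsymm d))
  obtain ⟨e, f, he, hf, hee, hff, hef⟩ := hU3
  have hu : e 0 - f 0 ∈ L := sub_mem (he 0) (hf 0)
  have huu : 2 ≤ B (e 0 - f 0) (e 0 - f 0) := by
    have hef0 : B (e 0) (f 0) = -1 := by simpa using hef 0 0
    simp only [map_sub, LinearMap.sub_apply, hee, hff, hsymm (f 0) (e 0), hef0]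
    norm_num
  obtain ⟨k, hk⟩ := exists_isDecomposition h1 hu huu hφG
  have hk2 := hk.add_two h1 h1 hu huu
  rw [one_mul] at hk2
  exact ⟨k + 2, by omega, hk2⟩
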